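/- arXiv:1007.0672 — 2 statements merged into one kernel-verified Lean document; each statement's English description precedes it below -/
import Mathlib

section
/- Let W ⊆ ℂ² be open, γ : [0,1] → W a piecewise continuously differentiable path with endpoints p₀ = γ(0) and p₁ = γ(1), g : W → ℂ holomorphic, and ω₁, …, ω_n (n ≥ 1) holomorphic 1-forms on W. Then ∫_γ (dg) ω₁ ω₂ ⋯ ω_n = g(p₁) · ∫_γ ω₁ ω₂ ⋯ ω_n − ∫_γ (g·ω₁) ω₂ ⋯ ω_n. -/
/-- A 1-form `P dx + Q dy` on `ℂ²` (with coordinates `(x, y)`),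
given by its pair of coefficient functions `(P, Q)`. -/
abbrev Form1 : Type := ((ℂ × ℂ) → ℂ) × ((ℂ × ℂ) → ℂ)

/-- `ω` is a holomorphic 1-form on `W`. -/
def HolFormOn (W : Set (ℂ × ℂ)) (ω : Form1) : Prop :=
  DifferentiableOn ℂ ω.1 W ∧ DifferentiableOn ℂ ω.2 W

/-- The pullback `γ*ω` of the 1-form `ω = P dx + Q dy` along a path `γ = (γ₁, γ₂)`:
`(γ*ω)(s) = P(γ(s))·γ₁′(s) + Q(γ(s))·γ₂′(s)`. -/
noncomputable def pull (γ : ℝ → ℂ × ℂ) (ω : Form1) (s : ℝ) : ℂ :=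
  ω.1 (γ s) * deriv (fun u => (γ u).1) s + ω.2 (γ s) * deriv (fun u => (γ u).2) s

/-- The iterated integral `I(γ; ω₁,…,ω_k; s)`, defined recursively:
`I(γ; ; s) = 1` and `I(γ; ω₁,…,ω_k; s) = ∫₀^s (γ*ω₁)(u) · I(γ; ω₂,…,ω_k; u) du`.
The iterated integral `∫_γ ω₁⋯ω_k` is `iterInt γ [ω₁,…,ω_k] 1`. -/
noncomputable def iterInt (γ : ℝ → ℂ × ℂ) : List Form1 → ℝ → ℂ
  | [], _ => 1
  | ω :: ωs, s => ∫ u in (0:ℝ)..s, pull γ ω u * iterInt γ ωs u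

/-- `γ : [0,1] → ℂ²` is a piecewise continuously differentiable path. -/
def PiecewiseC1 (γ : ℝ → ℂ × ℂ) : Prop :=
  ContinuousOn γ (Set.Icc 0 1) ∧
  ∃ (n : ℕ) (t : Fin (n + 1) → ℝ), StrictMono t ∧ t 0 = 0 ∧ t (Fin.last n) = 1 ∧
    ∀ i : Fin n, ContDiffOn ℝ 1 γ (Set.Icc (t i.castSucc) (t i.succ))

/-- The differential `dg = (∂g/∂x) dx + (∂g/∂y) dy` of a function `g`. -/
noncomputable def dform (g : ℂ × ℂ → ℂ) : Form1 :=
  (fun p => fderiv ℂ g p (1, 0), fun p => fderiv ℂ g p (0, 1))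

/-- The 1-form `g·ω`. -/
def smulForm (g : ℂ × ℂ → ℂ) (ω : Form1) : Form1 :=
  (fun p => g p * ω.1 p, fun p => g p * ω.2 p)

open Set Filter Topology MeasureTheory

theorem continuousOn_fderiv_apply_of_differentiableOn_complex
    {E : Type*} [NormedAddCommGroup E] [NormedSpace ℂ E] {W : Set E} (hW : IsOpen W)
    {g : E → ℂ} (hg : DifferentiableOn ℂ g W) (v : E) :
    ContinuousOn (fun p => fderiv ℂ g p v) W := by
  intro p₀ hp₀
  refine ContinuousAt.continuousWithinAt ?_
  have hline : ∀ p : E, HasDerivAt (fun z : ℂ => p + z • v) v 0 := fun p => by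
    simpa using ((hasDerivAt_id (0 : ℂ)).smul_const v).const_add p
  have hcont : Continuous fun q : E × ℂ => q.1 + q.2 • v := by fun_prop
  have hnhds : (fun q : E × ℂ => q.1 + q.2 • v) ⁻¹' W ∈ 𝓝 (p₀, (0 : ℂ)) :=
    (hW.preimage hcont).mem_nhds (by simpa using hp₀)
  rw [nhds_prod_eq, mem_prod_iff] at hnhds
  obtain ⟨V, hV, U', hU', hVU'⟩ := hnhds
  obtain ⟨U, hUU', hU, h0U⟩ := mem_nhds_iff.1 hU'
  have hVU : ∀ p ∈ V, ∀ z ∈ U, p + z • v ∈ W := fun p hp z hz =>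
    hVU' (mk_mem_prod hp (hUU' hz))
  have hunif : TendstoLocallyUniformlyOn (fun (p : E) (z : ℂ) => g (p + z • v))
      (fun z => g (p₀ + z • v)) (𝓝 p₀) U := by
    rw [tendstoLocallyUniformlyOn_iff_forall_tendsto]
    intro z hz
    have hgc : ContinuousAt g (p₀ + z • v) :=
      (hg.differentiableAt (hW.mem_nhds (hVU p₀ (mem_of_mem_nhds hV) z hz))).continuousAt
    have h₁ : Tendsto (fun q : E × ℂ => g (q.1 + q.2 • v)) (𝓝 p₀ ×ˢ 𝓝[U] z)
        (𝓝 (g (p₀ + z • v))) := by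
      have : ContinuousAt (fun q : E × ℂ => g (q.1 + q.2 • v)) (p₀, z) :=
        ContinuousAt.comp (f := fun q : E × ℂ => q.1 + q.2 • v) hgc hcont.continuousAt
      refine this.tendsto.mono_left ?_
      rw [nhds_prod_eq]
      exact prod_mono le_rfl nhdsWithin_le_nhds
    have h₂ : Tendsto (fun q : E × ℂ => g (p₀ + q.2 • v)) (𝓝 p₀ ×ˢ 𝓝[U] z)
        (𝓝 (g (p₀ + z • v))) := by
      have : ContinuousAt (fun w : ℂ => g (p₀ + w • v)) z :=
        ContinuousAt.comp (f := fun w : ℂ => p₀ + w • v) hgc (by fun_prop)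
      exact (this.tendsto.mono_left nhdsWithin_le_nhds).comp tendsto_snd
    exact (h₂.prodMk_nhds h₁).mono_right (nhds_le_uniformity _)
  have hderiv : ∀ p ∈ V, deriv (fun z : ℂ => g (p + z • v)) 0 = fderiv ℂ g p v := by
    intro p hp
    have hpW : p + (0 : ℂ) • v ∈ W := hVU p hp 0 h0U
    have := (hg.differentiableAt (hW.mem_nhds hpW)).hasFDerivAt.comp_hasDerivAt (0 : ℂ) (hline p)
    simpa [Function.comp_def] using this.deriv
  have hlim := (hunif.deriv (Filter.mem_of_superset hV fun p hp z hz =>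
    ((hg.differentiableAt (hW.mem_nhds (hVU p hp z hz))).comp z
      (by fun_prop : DifferentiableAt ℂ (fun w : ℂ => p + w • v) z)).differentiableWithinAt)
    hU).tendsto_at h0U
  rw [hderiv p₀ (mem_of_mem_nhds hV)] at hlim
  exact hlim.congr' (Filter.mem_of_superset hV hderiv)

theorem Fin.exists_mem_Icc_of_mem_Ico {n : ℕ} (t : Fin (n + 1) → ℝ) (j : Fin (n + 1)) {x : ℝ}
    (hx : x ∈ Ico (t 0) (t j)) : ∃ i : Fin n, x ∈ Icc (t i.castSucc) (t i.succ) := by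
  induction j using Fin.induction with
  | zero => exact absurd hx.1 (not_le.2 hx.2)
  | succ i ih =>
    rcases lt_or_ge x (t i.castSucc) with h | h
    · exact ih ⟨hx.1, h⟩
    · exact ⟨i, h, hx.2.le⟩

section ContDiffOnIcc

variable {E : Type*} [NormedAddCommGroup E] [NormedSpace ℝ E] {f : ℝ → E} {a b : ℝ}

theorem ContDiffOn.continuousAt_deriv_of_mem_Ioo (hf : ContDiffOn ℝ 1 f (Icc a b))
    {x : ℝ} (hx : x ∈ Ioo a b) : ContinuousAt (deriv f) x :=
  ((hf.mono Ioo_subset_Icc_self).continuousOn_deriv_of_isOpen isOpen_Ioo le_rfl).continuousAt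
    (isOpen_Ioo.mem_nhds hx)

theorem ContDiffOn.hasDerivAt_of_mem_Ioo (hf : ContDiffOn ℝ 1 f (Icc a b))
    {x : ℝ} (hx : x ∈ Ioo a b) : HasDerivAt f (deriv f x) x :=
  ((hf.contDiffAt (Icc_mem_nhds hx.1 hx.2)).differentiableAt one_ne_zero).hasDerivAt

theorem ContDiffOn.integrableOn_deriv_Icc (hab : a < b) (hf : ContDiffOn ℝ 1 f (Icc a b)) :
    IntegrableOn (deriv f) (Icc a b) := by
  have h := (hf.continuousOn_derivWithin (uniqueDiffOn_Icc hab) le_rfl).integrableOn_Icc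
    (μ := volume)
  rw [integrableOn_Icc_iff_integrableOn_Ioo] at h ⊢
  exact h.congr_fun (fun x hx => derivWithin_of_mem_nhds (Icc_mem_nhds hx.1 hx.2))
    measurableSet_Ioo

end ContDiffOnIcc

namespace PiecewiseC1

variable {γ : ℝ → ℂ × ℂ}

theorem intervalIntegrable_deriv (hγ : PiecewiseC1 γ) :
    IntervalIntegrable (deriv fun u => (γ u).1) volume 0 1 ∧
      IntervalIntegrable (deriv fun u => (γ u).2) volume 0 1 := by
  obtain ⟨-, n, t, ht, h0, h1, hC⟩ := hγ
  have key : ∀ f : ℝ → ℂ, (∀ i : Fin n, ContDiffOn ℝ 1 f (Icc (t i.castSucc) (t i.succ))) →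
      IntervalIntegrable (deriv f) volume 0 1 := by
    intro f hf
    rw [intervalIntegrable_iff_integrableOn_Ico_of_le zero_le_one]
    refine IntegrableOn.mono_set (integrableOn_finite_iUnion.2 fun i =>
      (hf i).integrableOn_deriv_Icc (ht i.castSucc_lt_succ)) fun x hx => ?_
    rw [← h0, ← h1] at hx
    exact mem_iUnion.2 (Fin.exists_mem_Icc_of_mem_Ico t _ hx)
  exact ⟨key _ fun i => (hC i).fst, key _ fun i => (hC i).snd⟩

theorem exists_countable_regular (hγ : PiecewiseC1 γ) :
    ∃ S : Set ℝ, S.Countable ∧ ∀ x ∈ Ioo (0 : ℝ) 1 \ S,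
      HasDerivAt (fun u => (γ u).1) (deriv (fun u => (γ u).1) x) x ∧
      HasDerivAt (fun u => (γ u).2) (deriv (fun u => (γ u).2) x) x ∧
      ContinuousAt (deriv fun u => (γ u).1) x ∧ ContinuousAt (deriv fun u => (γ u).2) x := by
  obtain ⟨-, n, t, -, h0, h1, hC⟩ := hγ
  refine ⟨range t, (finite_range t).countable, fun x hx => ?_⟩
  have hx' : x ∈ Ico (t 0) (t (Fin.last n)) := by
    rw [h0, h1]
    exact Ioo_subset_Ico_self hx.1
  obtain ⟨i, hi⟩ := Fin.exists_mem_Icc_of_mem_Ico t _ hx'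
  have hxi : x ∈ Ioo (t i.castSucc) (t i.succ) :=
    ⟨hi.1.lt_of_ne fun h => hx.2 ⟨_, h⟩, hi.2.lt_of_ne fun h => hx.2 ⟨_, h.symm⟩⟩
  exact ⟨(hC i).fst.hasDerivAt_of_mem_Ioo hxi, (hC i).snd.hasDerivAt_of_mem_Ioo hxi,
    (hC i).fst.continuousAt_deriv_of_mem_Ioo hxi, (hC i).snd.continuousAt_deriv_of_mem_Ioo hxi⟩

variable {W : Set (ℂ × ℂ)}

theorem intervalIntegrable_pull (hγ : PiecewiseC1 γ) (hγW : MapsTo γ (Icc 0 1) W)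
    {ω : Form1} (h₁ : ContinuousOn ω.1 W) (h₂ : ContinuousOn ω.2 W) :
    IntervalIntegrable (pull γ ω) volume 0 1 := by
  rw [← uIcc_of_le zero_le_one] at hγW
  have hc : ContinuousOn γ (uIcc 0 1) := by
    rw [uIcc_of_le zero_le_one]
    exact hγ.1
  exact (hγ.intervalIntegrable_deriv.1.continuousOn_mul (h₁.comp hc hγW)).add
    (hγ.intervalIntegrable_deriv.2.continuousOn_mul (h₂.comp hc hγW))

theorem continuousOn_iterInt (hγ : PiecewiseC1 γ) (hγW : MapsTo γ (Icc 0 1) W)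
    {ωs : List Form1} (hωs : ∀ ω ∈ ωs, HolFormOn W ω) :
    ContinuousOn (iterInt γ ωs) (Icc 0 1) := by
  induction ωs with
  | nil => exact continuousOn_const
  | cons ω ωs ih =>
    have hω := hωs ω List.mem_cons_self
    have hint := hγ.intervalIntegrable_pull hγW hω.1.continuousOn hω.2.continuousOn
    have hI := ih fun ω' h => hωs ω' (List.mem_cons_of_mem _ h)
    rw [← uIcc_of_le zero_le_one] at hI ⊢
    exact intervalIntegral.continuousOn_primitive_interval' (hint.mul_continuousOn hI) left_mem_uIcc

end PiecewiseC1

theorem continuousAt_pull {γ : ℝ → ℂ × ℂ} {ω : Form1} {x : ℝ} (hγ : ContinuousAt γ x)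
    (h₁ : ContinuousAt ω.1 (γ x)) (h₂ : ContinuousAt ω.2 (γ x))
    (hd₁ : ContinuousAt (deriv fun u => (γ u).1) x)
    (hd₂ : ContinuousAt (deriv fun u => (γ u).2) x) : ContinuousAt (pull γ ω) x :=
  ((h₁.comp hγ).mul hd₁).add ((h₂.comp hγ).mul hd₂)

theorem hasDerivAt_comp_pull_dform {γ : ℝ → ℂ × ℂ} {g : ℂ × ℂ → ℂ} {x : ℝ}
    (hg : DifferentiableAt ℂ g (γ x))
    (h₁ : HasDerivAt (fun u => (γ u).1) (deriv (fun u => (γ u).1) x) x)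
    (h₂ : HasDerivAt (fun u => (γ u).2) (deriv (fun u => (γ u).2) x) x) :
    HasDerivAt (fun u => g (γ u)) (pull γ (dform g) x) x := by
  have h := (hg.hasFDerivAt.restrictScalars ℝ).comp_hasDerivAt x (h₁.prodMk h₂)
  refine h.congr_deriv ?_
  simp only [pull, dform, ContinuousLinearMap.coe_restrictScalars']
  have hsplit : ∀ a b : ℂ, ((a, b) : ℂ × ℂ) = a • (1, 0) + b • (0, 1) := by simp
  rw [hsplit, map_add, map_smul, map_smul, smul_eq_mul, smul_eq_mul, mul_comm, add_right_inj,
    mul_comm]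

theorem pull_smulForm (γ : ℝ → ℂ × ℂ) (g : ℂ × ℂ → ℂ) (ω : Form1) (s : ℝ) :
    pull γ (smulForm g ω) s = g (γ s) * pull γ ω s := by
  simp only [pull, smulForm]
  ring

/-- Integrating an exact form `dg` in the first slot of an iterated integral:
`∫_γ (dg) ω₁ ω₂ ⋯ ω_n = g(p₁) · ∫_γ ω₁ ω₂ ⋯ ω_n − ∫_γ (g·ω₁) ω₂ ⋯ ω_n`. -/
theorem iterated_integral_exact_first
    (W : Set (ℂ × ℂ)) (hW : IsOpen W)
    (γ : ℝ → ℂ × ℂ) (hγ : PiecewiseC1 γ) (hγW : ∀ s ∈ Set.Icc (0:ℝ) 1, γ s ∈ W)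
    (g : ℂ × ℂ → ℂ) (hg : DifferentiableOn ℂ g W)
    (ω₁ : Form1) (ωs : List Form1)
    (hω₁ : HolFormOn W ω₁) (hωs : ∀ ω ∈ ωs, HolFormOn W ω) :
    iterInt γ (dform g :: ω₁ :: ωs) 1
      = g (γ 1) * iterInt γ (ω₁ :: ωs) 1 - iterInt γ (smulForm g ω₁ :: ωs) 1 := by
  have hcg : ContinuousOn (fun u => g (γ u)) (Set.Icc 0 1) := hg.continuousOn.comp hγ.1 hγW
  have hdg : ∀ v, ContinuousOn (fun p => fderiv ℂ g p v) W :=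
    continuousOn_fderiv_apply_of_differentiableOn_complex hW hg
  have hI₁ : ContinuousOn (iterInt γ (ω₁ :: ωs)) (Set.Icc 0 1) :=
    hγ.continuousOn_iterInt hγW (List.forall_mem_cons.2 ⟨hω₁, hωs⟩)
  have hIs : ContinuousOn (iterInt γ ωs) (Set.Icc 0 1) := hγ.continuousOn_iterInt hγW hωs
  have hint_dg : IntervalIntegrable
      (fun u => pull γ (dform g) u * iterInt γ (ω₁ :: ωs) u) volume 0 1 :=
    (hγ.intervalIntegrable_pull hγW (hdg _) (hdg _)).mul_continuousOn
      (by rwa [uIcc_of_le zero_le_one])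
  have hint₁ : IntervalIntegrable (fun u => pull γ ω₁ u * iterInt γ ωs u) volume 0 1 :=
    (hγ.intervalIntegrable_pull hγW hω₁.1.continuousOn hω₁.2.continuousOn).mul_continuousOn
      (by rwa [uIcc_of_le zero_le_one])
  have hint_g : IntervalIntegrable
      (fun u => g (γ u) * (pull γ ω₁ u * iterInt γ ωs u)) volume 0 1 :=
    hint₁.continuousOn_mul (by rwa [uIcc_of_le zero_le_one])
  obtain ⟨S, hS, hreg⟩ := hγ.exists_countable_regular
  have hderiv : ∀ x ∈ Ioo (0 : ℝ) 1 \ S,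
      HasDerivAt (fun u => g (γ u) * iterInt γ (ω₁ :: ωs) u)
        (pull γ (dform g) x * iterInt γ (ω₁ :: ωs) x
          + g (γ x) * (pull γ ω₁ x * iterInt γ ωs x)) x := by
    intro x hx
    obtain ⟨h₁, h₂, hd₁, hd₂⟩ := hreg x hx
    have hxI : Set.Icc (0 : ℝ) 1 ∈ 𝓝 x := Icc_mem_nhds hx.1.1 hx.1.2
    have hWx : W ∈ 𝓝 (γ x) := hW.mem_nhds (hγW x (mem_of_mem_nhds hxI))
    refine (hasDerivAt_comp_pull_dform (hg.differentiableAt hWx) h₁ h₂).mul ?_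
    refine intervalIntegral.integral_hasDerivAt_right (hint₁.mono_set ?_)
      ⟨Ioc 0 1, Ioc_mem_nhds hx.1.1 hx.1.2, hint₁.aestronglyMeasurable⟩
      ((continuousAt_pull (hγ.1.continuousAt hxI) (hω₁.1.continuousOn.continuousAt hWx)
        (hω₁.2.continuousOn.continuousAt hWx) hd₁ hd₂).mul (hIs.continuousAt hxI))
    rw [uIcc_of_le hx.1.1.le, uIcc_of_le zero_le_one]
    exact Icc_subset_Icc_right hx.1.2.le
  have hparts := integral_eq_of_hasDerivAt_off_countable_of_le _ _ zero_le_one hS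
    (hcg.mul hI₁) hderiv (hint_dg.add hint_g)
  rw [intervalIntegral.integral_add hint_dg hint_g] at hparts
  have hzero : iterInt γ (ω₁ :: ωs) 0 = 0 := intervalIntegral.integral_same
  have hsmul : iterInt γ (smulForm g ω₁ :: ωs) 1
      = ∫ u in (0 : ℝ)..1, g (γ u) * (pull γ ω₁ u * iterInt γ ωs u) := by
    simp only [iterInt, pull_smulForm, mul_assoc]
  rw [hsmul, eq_sub_iff_add_eq]
  simp only [Pi.mul_apply, hzero, mul_zero, sub_zero] at hparts
  exact hparts
end

section
/- Let W ⊆ ℂ² be open, R : W → ℂ holomorphic, U ⊆ ℂ open, and Γ : U × [0,1] → W a twice continuously differentiable map such that R(Γ(t,s)) = t for all (t,s) ∈ U × [0,1], Γ(t,0) = Γ(t,1) for all t ∈ U, and the base point Γ(t,0) lies on the line {x = 0} for every t ∈ U (i.e. the first coordinate of Γ(t,0) is 0). For i = 1, …, n let ω_i = f_i dx be a holomorphic 1-form on W with no dy-component (f_i : W → ℂ holomorphic), and let ξ_i be a Gelfand–Leray derivative of ω_i with respect to R (i.e. dω_i = dR ∧ ξ_i). Then the function t ↦ ∮_{Γ(t,·)}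 ω₁ ω₂ ⋯ ω_n is differentiable on U and its derivative at every t ∈ U equals Σ_{i=1}^n ∮_{Γ(t,·)} ω₁ ⋯ ω_{i−1} ξ_i ω_{i+1} ⋯ ω_n. -/
/-- The line integral `∮_γ ω = ∫₀¹ (γ*ω)(s) ds`. -/
noncomputable def lineInt (γ : ℝ → ℂ × ℂ) (ω : Form1) : ℂ :=
  ∫ s in (0:ℝ)..1, pull γ ω s

/-- `ξ = a dx + b dy` is a Gelfand–Leray derivative of `ω = P dx + Q dy` with respect to `R`
on `W`, i.e. `dω = dR ∧ ξ`:  `∂Q/∂x − ∂P/∂y = (∂R/∂x)·b − (∂R/∂y)·a` on `W`. -/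
def IsGLDerivOn (W : Set (ℂ × ℂ)) (R : ℂ × ℂ → ℂ) (ω ξ : Form1) : Prop :=
  ∀ p ∈ W, fderiv ℂ ω.2 p (1, 0) - fderiv ℂ ω.1 p (0, 1)
    = fderiv ℂ R p (1, 0) * ξ.2 p - fderiv ℂ R p (0, 1) * ξ.1 p

open Set Filter Topology MeasureTheory

/-- A holomorphic function on an open subset of a finite-dimensional complex vector space is
continuously differentiable. -/
theorem contDiffOn_one_of_differentiableOn_complex {E : Type*} [NormedAddCommGroup E]
    [NormedSpace ℂ E] [FiniteDimensional ℂ E] {W : Set E} (hW : IsOpen W) {f : E → ℂ}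
    (hf : DifferentiableOn ℂ f W) : ContDiffOn ℂ 1 f W := by
  have : ProperSpace E := FiniteDimensional.proper ℂ E
  rw [show (1 : WithTop ℕ∞) = 0 + 1 from rfl, contDiffOn_succ_iff_fderiv_of_isOpen hW]
  refine ⟨hf, by simp, contDiffOn_zero.2 (continuousOn_clm_apply.2 fun e p₀ hp₀ => ?_)⟩
  obtain ⟨r, hr, hrW⟩ := Metric.isOpen_iff.1 hW p₀ hp₀
  obtain ⟨δ, hδ, hδr⟩ : ∃ δ > 0, δ * ‖e‖ < r / 2 := by
    refine ⟨r / 2 / (‖e‖ + 1), by positivity, ?_⟩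
    rw [div_mul_eq_mul_div, div_lt_iff₀ (by positivity)]
    nlinarith
  have hmaps : ∀ p ∈ Metric.closedBall p₀ (r / 2), ∀ z ∈ Metric.closedBall (0 : ℂ) δ,
      p + z • e ∈ W := by
    intro p hp z hz
    apply hrW
    rw [Metric.mem_closedBall, dist_eq_norm] at hp hz
    rw [Metric.mem_ball, dist_eq_norm]
    calc ‖p + z • e - p₀‖ = ‖(p - p₀) + z • e‖ := by congr 1; abel
      _ ≤ ‖p - p₀‖ + ‖z‖ * ‖e‖ := (norm_add_le _ _).trans_eq (by rw [norm_smul])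
      _ ≤ r / 2 + δ * ‖e‖ := by
        rw [sub_zero] at hz
        gcongr
      _ < r := by linarith
  have hcont : ContinuousOn (fun q : E × ℂ => f (q.1 + q.2 • e))
      (Metric.closedBall p₀ (r / 2) ×ˢ Metric.closedBall (0 : ℂ) δ) :=
    hf.continuousOn.comp (by fun_prop) fun q hq => hmaps q.1 hq.1 q.2 hq.2
  have hunif := ((isCompact_closedBall p₀ (r / 2)).prod
    (isCompact_closedBall (0 : ℂ) δ)).uniformContinuousOn_of_continuous hcont
  have hmem : Metric.closedBall p₀ (r / 2) ∈ 𝓝 p₀ := Metric.closedBall_mem_nhds p₀ (by positivity)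
  have hlim := (UniformContinuousOn.tendstoUniformlyOn (F := fun (p : E) (z : ℂ) => f (p + z • e))
    hunif (mem_of_mem_nhds hmem)).mono Metric.ball_subset_closedBall
  rw [nhdsWithin_eq_nhds.2 hmem] at hlim
  have hline : ∀ p z, p + z • e ∈ W →
      HasDerivAt (fun z : ℂ => f (p + z • e)) (fderiv ℂ f (p + z • e) e) z := by
    intro p z hz
    have h := (hf.differentiableAt (hW.mem_nhds hz)).hasFDerivAt.comp_hasDerivAt z
      (((hasDerivAt_id z).smul_const e).const_add p)
    simpa [Function.comp_def] using h
  have hderiv := (hlim.tendstoLocallyUniformlyOn.deriv (by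
    filter_upwards [hmem] with p hp z hz
    exact (hline p z (hmaps p hp z
      (Metric.ball_subset_closedBall hz))).differentiableAt.differentiableWithinAt)
    Metric.isOpen_ball).tendsto_at (Metric.mem_ball_self hδ)
  have heq : ∀ p ∈ W, deriv (fun z : ℂ => f (p + z • e)) 0 = fderiv ℂ f p e := by
    intro p hp
    simpa using (hline p 0 (by simpa using hp)).deriv
  rw [heq p₀ hp₀] at hderiv
  refine (hderiv.congr' ?_).mono_left nhdsWithin_le_nhds
  filter_upwards [hW.mem_nhds hp₀] with p hp
  exact heq p hp

/-- A parametric primitive is jointly continuous in the parameter and the endpoint. -/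
theorem continuousOn_parametric_primitive {X E : Type*} [TopologicalSpace X]
    [FirstCountableTopology X] [NormedAddCommGroup E] [NormedSpace ℝ E] {U : Set X}
    {F : X × ℝ → E} (hF : ContinuousOn F (U ×ˢ Icc (0 : ℝ) 1)) :
    ContinuousOn (fun p : X × ℝ => ∫ u in (0 : ℝ)..p.2, F (p.1, u)) (U ×ˢ Icc (0 : ℝ) 1) := by
  have hext : Continuous (Function.uncurry fun (x : U) (u : ℝ) =>
      F (x.1, (projIcc (0 : ℝ) 1 zero_le_one u).1)) :=
    hF.comp_continuous (f := fun q : U × ℝ => (q.1.1, (projIcc (0 : ℝ) 1 zero_le_one q.2).1))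
      (by fun_prop) fun q => ⟨q.1.2, Subtype.coe_prop _⟩
  have hcont := intervalIntegral.continuous_parametric_primitive_of_continuous (μ := volume)
    (a₀ := 0) hext
  rw [continuousOn_iff_continuous_domRestrict]
  convert hcont.comp (g := fun q : U × ℝ => ∫ u in (0 : ℝ)..q.2,
    F (q.1.1, (projIcc (0 : ℝ) 1 zero_le_one u).1))
    (f := fun p : U ×ˢ Icc (0 : ℝ) 1 => ((⟨p.1.1, p.2.1⟩ : U), p.1.2)) (by fun_prop) using 1
  ext p
  refine intervalIntegral.integral_congr fun u hu => ?_
  rw [uIcc_of_le p.2.2.1] at hu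
  simp only
  rw [projIcc_of_mem zero_le_one ⟨hu.1, hu.2.trans p.2.2.2⟩]

/-- Differentiation under the integral sign, for continuous data on `U × [0, 1]`. -/
theorem hasFDerivAt_parametric_primitive {H E : Type*} [NormedAddCommGroup H] [NormedSpace ℝ H]
    [ProperSpace H] [NormedAddCommGroup E] [NormedSpace ℝ E] {U : Set H} (hU : IsOpen U)
    {F : H × ℝ → E} {F' : H × ℝ → H →L[ℝ] E}
    (hF : ContinuousOn F (U ×ˢ Icc (0 : ℝ) 1)) (hF' : ContinuousOn F' (U ×ˢ Icc (0 : ℝ) 1))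
    (hderiv : ∀ t ∈ U, ∀ s ∈ Icc (0 : ℝ) 1, HasFDerivAt (fun τ => F (τ, s)) (F' (t, s)) t)
    {t : H} (ht : t ∈ U) {s : ℝ} (hs : s ∈ Icc (0 : ℝ) 1) :
    HasFDerivAt (fun τ => ∫ u in (0 : ℝ)..s, F (τ, u)) (∫ u in (0 : ℝ)..s, F' (t, u)) t := by
  obtain ⟨r, hr, hrU⟩ := Metric.nhds_basis_closedBall.mem_iff.1 (hU.mem_nhds ht)
  obtain ⟨C, hC⟩ := ((isCompact_closedBall t r).prod (isCompact_Icc (a := (0 : ℝ)) (b := 1)))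
    |>.exists_bound_of_continuousOn (hF'.mono (prod_mono_left hrU))
  have hsub : Icc 0 s ⊆ Icc (0 : ℝ) 1 := Icc_subset_Icc_right hs.2
  have hIoc : ∀ u ∈ uIoc 0 s, u ∈ Icc (0 : ℝ) 1 := fun u hu => by
    rw [uIoc_of_le hs.1] at hu
    exact hsub (Ioc_subset_Icc_self hu)
  have hslice : ∀ τ ∈ U, ContinuousOn (fun u => F (τ, u)) (Icc (0 : ℝ) 1) := fun τ hτ =>
    hF.comp (by fun_prop) fun u hu => ⟨hτ, hu⟩
  have hslice' : ContinuousOn (fun u => F' (t, u)) (Icc (0 : ℝ) 1) :=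
    hF'.comp (by fun_prop) fun u hu => ⟨ht, hu⟩
  refine intervalIntegral.hasFDerivAt_integral_of_dominated_of_fderiv_le
    (F := fun τ u => F (τ, u)) (F' := fun τ u => F' (τ, u)) (bound := fun _ => C)
    (Metric.closedBall_mem_nhds t hr) ?_ ?_ ?_ ?_ (by simp) ?_
  · filter_upwards [hU.mem_nhds ht] with τ hτ
    exact (((hslice τ hτ).mono hsub).intervalIntegrable_of_Icc hs.1).aestronglyMeasurable_restrict_uIoc
  · exact ((hslice t ht).mono hsub).intervalIntegrable_of_Icc hs.1
  · exact ((hslice'.mono hsub).intervalIntegrable_of_Icc hs.1).aestronglyMeasurable_restrict_uIoc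
  · exact ae_of_all _ fun u hu τ hτ => hC (τ, u) ⟨hτ, hIoc u hu⟩
  · exact ae_of_all _ fun u hu τ hτ => hderiv τ (hrU hτ) u (hIoc u hu)

/-- The contraction of the pullback `G*ω` with the vector `v`, for a map `G` on the set `S`. -/
noncomputable def pullWithin (G : ℂ × ℝ → ℂ × ℂ) (S : Set (ℂ × ℝ)) (ω : Form1) (v : ℂ × ℝ)
    (p : ℂ × ℝ) : ℂ :=
  ω.1 (G p) * (fderivWithin ℝ G S p v).1 + ω.2 (G p) * (fderivWithin ℝ G S p v).2

section PullWithin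

variable {G : ℂ × ℝ → ℂ × ℂ} {S : Set (ℂ × ℝ)} {W : Set (ℂ × ℂ)} {ω : Form1}

theorem contDiffOn_fderivWithin_apply_const (hS : UniqueDiffOn ℝ S) (hG : ContDiffOn ℝ 2 G S)
    (v : ℂ × ℝ) : ContDiffOn ℝ 1 (fun p => fderivWithin ℝ G S p v) S :=
  (hG.fderivWithin hS (m := 1) (by norm_num)).clm_apply contDiffOn_const

theorem contDiffOn_pullWithin (hS : UniqueDiffOn ℝ S) (hG : ContDiffOn ℝ 2 G S) (hW : IsOpen W)
    (hGW : MapsTo G S W) (hω : HolFormOn W ω) (v : ℂ × ℝ) :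
    ContDiffOn ℝ 1 (pullWithin G S ω v) S := by
  have hv := contDiffOn_fderivWithin_apply_const hS hG v
  have hcoef : ∀ f : ℂ × ℂ → ℂ, DifferentiableOn ℂ f W → ContDiffOn ℝ 1 (fun p => f (G p)) S :=
    fun f hf => ((contDiffOn_one_of_differentiableOn_complex hW hf).restrict_scalars ℝ).comp
      (hG.of_le (by norm_num)) hGW
  exact ((hcoef _ hω.1).mul hv.fst).add ((hcoef _ hω.2).mul hv.snd)

theorem fderivWithin_pullWithin_apply (hS : UniqueDiffOn ℝ S) (hG : ContDiffOn ℝ 2 G S)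
    (hW : IsOpen W) (hGW : MapsTo G S W) (hω : HolFormOn W ω) (v w : ℂ × ℝ) {p : ℂ × ℝ}
    (hp : p ∈ S) :
    fderivWithin ℝ (pullWithin G S ω v) S p w =
      fderiv ℂ ω.1 (G p) (fderivWithin ℝ G S p w) * (fderivWithin ℝ G S p v).1
        + ω.1 (G p) * (fderivWithin ℝ (fderivWithin ℝ G S) S p w v).1
        + (fderiv ℂ ω.2 (G p) (fderivWithin ℝ G S p w) * (fderivWithin ℝ G S p v).2
        + ω.2 (G p) * (fderivWithin ℝ (fderivWithin ℝ G S) S p w v).2) := by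
  have hGd : HasFDerivWithinAt G (fderivWithin ℝ G S p) S p :=
    (hG.differentiableOn (by norm_num) p hp).hasFDerivWithinAt
  have hGdd : HasFDerivWithinAt (fderivWithin ℝ G S) (fderivWithin ℝ (fderivWithin ℝ G S) S p)
      S p :=
    ((hG.fderivWithin hS (m := 1) (by norm_num)).differentiableOn
      (by norm_num) p hp).hasFDerivWithinAt
  have hv := hGdd.clm_apply (hasFDerivWithinAt_const v p S)
  have hcoef : ∀ f : ℂ × ℂ → ℂ, DifferentiableOn ℂ f W →
      HasFDerivWithinAt (fun p => f (G p))
        (((fderiv ℂ f (G p)).restrictScalars ℝ).comp (fderivWithin ℝ G S p)) S p := fun f hf =>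
    ((hf.differentiableAt (hW.mem_nhds (hGW hp))).hasFDerivAt.restrictScalars ℝ)
      |>.comp_hasFDerivWithinAt p hGd
  have h := ((hcoef _ hω.1).mul hv.fst).add ((hcoef _ hω.2).mul hv.snd)
  have h' : fderivWithin ℝ (pullWithin G S ω v) S p = _ := h.fderivWithin (hS p hp)
  rw [h']
  simp
  ring

/-- Cartan's formula `d(G*ω) = G*(dω) = G*(dR ∧ ξ)`, where `R ∘ G` is the first coordinate. -/
theorem fderivWithin_pullWithin_sub {R : ℂ × ℂ → ℂ} {ξ : Form1} (hS : UniqueDiffOn ℝ S)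
    (hSi : S ⊆ closure (interior S)) (hG : ContDiffOn ℝ 2 G S) (hW : IsOpen W)
    (hGW : MapsTo G S W) (hR : DifferentiableOn ℂ R W) (hRG : ∀ p ∈ S, R (G p) = p.1)
    (hω : HolFormOn W ω) (hGL : IsGLDerivOn W R ω ξ) (v w : ℂ × ℝ) {p : ℂ × ℝ} (hp : p ∈ S) :
    fderivWithin ℝ (pullWithin G S ω v) S p w - fderivWithin ℝ (pullWithin G S ω w) S p v =
      w.1 * pullWithin G S ξ v p - v.1 * pullWithin G S ξ w p := by
  have hsymm : fderivWithin ℝ (fderivWithin ℝ G S) S p w v =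
      fderivWithin ℝ (fderivWithin ℝ G S) S p v w :=
    ((hG p hp).isSymmSndFDerivWithinAt (by simp) hS (hSi hp) hp).eq w v
  have hdR : ∀ u, fderiv ℂ R (G p) (fderivWithin ℝ G S p u) = u.1 := by
    intro u
    have h1 : HasFDerivWithinAt (fun p => R (G p))
        (((fderiv ℂ R (G p)).restrictScalars ℝ).comp (fderivWithin ℝ G S p)) S p :=
      ((hR.differentiableAt (hW.mem_nhds (hGW hp))).hasFDerivAt.restrictScalars ℝ)
        |>.comp_hasFDerivWithinAt p (hG.differentiableOn (by norm_num) p hp).hasFDerivWithinAt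
    have h2 : HasFDerivWithinAt (fun p => R (G p)) (ContinuousLinearMap.fst ℝ ℂ ℝ) S p :=
      hasFDerivWithinAt_fst.congr hRG (hRG p hp)
    simpa using congrArg (fun L => L u) ((hS p hp).eq h1 h2)
  have hcoord : ∀ (L : ℂ × ℂ →L[ℂ] ℂ) (z : ℂ × ℂ), L z = z.1 * L (1, 0) + z.2 * L (0, 1) := by
    intro L z
    conv_lhs => rw [show z = z.1 • ((1 : ℂ), (0 : ℂ)) + z.2 • ((0 : ℂ), (1 : ℂ)) by ext <;> simp]
    simp only [map_add, map_smul, smul_eq_mul]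
  have hv := hdR v
  have hw := hdR w
  rw [hcoord] at hv hw
  rw [fderivWithin_pullWithin_apply hS hG hW hGW hω v w hp,
    fderivWithin_pullWithin_apply hS hG hW hGW hω w v hp, hsymm,
    hcoord (fderiv ℂ ω.1 (G p)) (fderivWithin ℝ G S p w),
    hcoord (fderiv ℂ ω.2 (G p)) (fderivWithin ℝ G S p w),
    hcoord (fderiv ℂ ω.1 (G p)) (fderivWithin ℝ G S p v),
    hcoord (fderiv ℂ ω.2 (G p)) (fderivWithin ℝ G S p v), ← hv, ← hw]
  unfold pullWithin
  linear_combination ((fderivWithin ℝ G S p w).1 * (fderivWithin ℝ G S p v).2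
    - (fderivWithin ℝ G S p w).2 * (fderivWithin ℝ G S p v).1) * hGL (G p) (hGW hp)

end PullWithin

/-- For fixed `s`, the derivative in the parameter of a function differentiable on `U × [0, 1]`. -/
theorem hasFDerivAt_left_of_differentiableOn {E : Type*} [NormedAddCommGroup E] [NormedSpace ℝ E]
    {U : Set ℂ} (hU : IsOpen U) {F : ℂ × ℝ → E} (hF : DifferentiableOn ℝ F (U ×ˢ Icc (0 : ℝ) 1))
    {t : ℂ} (ht : t ∈ U) {s : ℝ} (hs : s ∈ Icc (0 : ℝ) 1) :
    HasFDerivAt (fun τ => F (τ, s))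
      ((fderivWithin ℝ F (U ×ˢ Icc (0 : ℝ) 1) (t, s)).comp (ContinuousLinearMap.inl ℝ ℂ ℝ)) t :=
  have hmaps : MapsTo (fun τ => (τ, s)) U (U ×ˢ Icc (0 : ℝ) 1) := fun _ hτ => ⟨hτ, hs⟩
  ((hF (t, s) ⟨ht, hs⟩).hasFDerivWithinAt.comp t
    (hasFDerivAt_prodMk_left t s).hasFDerivWithinAt hmaps).hasFDerivAt (hU.mem_nhds ht)

/-- For fixed `t`, the derivative in `s` of a function differentiable on `U × [0, 1]`. -/
theorem hasDerivAt_right_of_differentiableOn {E : Type*} [NormedAddCommGroup E] [NormedSpace ℝ E]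
    {U : Set ℂ} {F : ℂ × ℝ → E} (hF : DifferentiableOn ℝ F (U ×ˢ Icc (0 : ℝ) 1))
    {t : ℂ} (ht : t ∈ U) {s : ℝ} (hs : s ∈ Ioo (0 : ℝ) 1) :
    HasDerivAt (fun u => F (t, u)) (fderivWithin ℝ F (U ×ˢ Icc (0 : ℝ) 1) (t, s) (0, 1)) s := by
  have h := ((hF (t, s) ⟨ht, Ioo_subset_Icc_self hs⟩).hasFDerivWithinAt.comp (s := Icc 0 1) s
    (hasFDerivAt_prodMk_right t s).hasFDerivWithinAt
    fun u hu => ⟨ht, hu⟩).hasFDerivAt (Icc_mem_nhds hs.1 hs.2)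
  simpa [Function.comp_def] using h.hasDerivAt

/-- `J` has derivative `v ↦ v D + B X(v)` in the parameter `t ∈ U` and `B x'` in `s ∈ [0, 1]`. -/
structure HasVariation (U : Set ℂ) (x' : ℂ × ℝ → ℂ) (X : ℂ × ℝ → ℂ →L[ℝ] ℂ)
    (J D B : ℂ × ℝ → ℂ) : Prop where
  continuousOn : ContinuousOn J (U ×ˢ Icc (0 : ℝ) 1)
  continuousOn_deriv : ContinuousOn D (U ×ˢ Icc (0 : ℝ) 1)
  continuousOn_boundary : ContinuousOn B (U ×ˢ Icc (0 : ℝ) 1)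
  hasFDerivAt : ∀ t ∈ U, ∀ s ∈ Icc (0 : ℝ) 1, HasFDerivAt (fun τ => J (τ, s))
    (D (t, s) • ContinuousLinearMap.id ℝ ℂ + B (t, s) • X (t, s)) t
  hasDerivAt : ∀ t ∈ U, ∀ s ∈ Ioo (0 : ℝ) 1,
    HasDerivAt (fun u => J (t, u)) (B (t, s) * x' (t, s)) s

theorem HasVariation.congr {U : Set ℂ} (hU : IsOpen U) {x' : ℂ × ℝ → ℂ} {X : ℂ × ℝ → ℂ →L[ℝ] ℂ}
    {J D B J₁ D₁ : ℂ × ℝ → ℂ} (h : HasVariation U x' X J D B)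
    (hJ : EqOn J₁ J (U ×ˢ Icc (0 : ℝ) 1)) (hD : EqOn D₁ D (U ×ˢ Icc (0 : ℝ) 1)) :
    HasVariation U x' X J₁ D₁ B where
  continuousOn := h.continuousOn.congr hJ
  continuousOn_deriv := h.continuousOn_deriv.congr hD
  continuousOn_boundary := h.continuousOn_boundary
  hasFDerivAt t ht s hs := by
    rw [hD ⟨ht, hs⟩]
    refine (h.hasFDerivAt t ht s hs).congr_of_eventuallyEq ?_
    filter_upwards [hU.mem_nhds ht] with τ hτ using hJ ⟨hτ, hs⟩
  hasDerivAt t ht s hs := by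
    refine (h.hasDerivAt t ht s hs).congr_of_eventuallyEq ?_
    filter_upwards [Icc_mem_nhds hs.1 hs.2] with u hu using hJ ⟨ht, hu⟩

/-- The induction step for iterated integrals: integrating against `q = f x'`, whose derivative in
the direction `v` of the parameter is `v η + ∂ₛ(f X(v))`. -/
theorem HasVariation.cons {U : Set ℂ} (hU : IsOpen U) {x' : ℂ × ℝ → ℂ} {X : ℂ × ℝ → ℂ →L[ℝ] ℂ}
    {J D B q η f : ℂ × ℝ → ℂ} (h : HasVariation U x' X J D B)
    (hX0 : ∀ t ∈ U, X (t, 0) = 0)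
    (hq : ContDiffOn ℝ 1 q (U ×ˢ Icc (0 : ℝ) 1)) (hη : ContinuousOn η (U ×ˢ Icc (0 : ℝ) 1))
    (hf : ContinuousOn f (U ×ˢ Icc (0 : ℝ) 1)) (hX : ContinuousOn X (U ×ˢ Icc (0 : ℝ) 1))
    (hfX : ∀ v, ContDiffOn ℝ 1 (fun p => f p * X p v) (U ×ˢ Icc (0 : ℝ) 1))
    (hqf : ∀ p ∈ U ×ˢ Icc (0 : ℝ) 1, q p = f p * x' p)
    (hvar : ∀ v, ∀ p ∈ U ×ˢ Icc (0 : ℝ) 1,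
      fderivWithin ℝ q (U ×ˢ Icc (0 : ℝ) 1) p (v, 0) = v * η p
        + fderivWithin ℝ (fun p => f p * X p v) (U ×ˢ Icc (0 : ℝ) 1) p (0, 1)) :
    HasVariation U x' X (fun p => ∫ u in (0 : ℝ)..p.2, q (p.1, u) * J (p.1, u))
      (fun p => ∫ u in (0 : ℝ)..p.2, (η (p.1, u) * J (p.1, u) + q (p.1, u) * D (p.1, u)))
      (fun p => f p * J p) where
  continuousOn := continuousOn_parametric_primitive (hq.continuousOn.mul h.continuousOn)
  continuousOn_deriv := continuousOn_parametric_primitive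
    ((hη.mul h.continuousOn).add (hq.continuousOn.mul h.continuousOn_deriv))
  continuousOn_boundary := hf.mul h.continuousOn
  hasFDerivAt t ht s hs := by
    have hUD : UniqueDiffOn ℝ (U ×ˢ Icc (0 : ℝ) 1) := hU.uniqueDiffOn.prod uniqueDiffOn_Icc_zero_one
    have hq' := hq.continuousOn_fderivWithin hUD le_rfl
    have hF' : ContinuousOn (fun p => q p • (D p • ContinuousLinearMap.id ℝ ℂ + B p • X p)
        + J p • (fderivWithin ℝ q (U ×ˢ Icc (0 : ℝ) 1) p).comp (ContinuousLinearMap.inl ℝ ℂ ℝ))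
        (U ×ˢ Icc (0 : ℝ) 1) :=
      (hq.continuousOn.smul ((h.continuousOn_deriv.smul continuousOn_const).add
        (h.continuousOn_boundary.smul hX))).add
        (h.continuousOn.smul (hq'.clm_comp continuousOn_const))
    have hsub : ∀ u ∈ Icc 0 s, (t, u) ∈ U ×ˢ Icc (0 : ℝ) 1 := fun u hu => ⟨ht, hu.1, hu.2.trans hs.2⟩
    have hslice : ∀ {E : Type} [NormedAddCommGroup E] [NormedSpace ℝ E] {g : ℂ × ℝ → E},
        ContinuousOn g (U ×ˢ Icc (0 : ℝ) 1) → ContinuousOn (fun u => g (t, u)) (Icc 0 s) :=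
      fun hg => hg.comp (by fun_prop) hsub
    have key := hasFDerivAt_parametric_primitive hU (hq.continuousOn.mul h.continuousOn) hF'
      (fun τ hτ u hu => (hasFDerivAt_left_of_differentiableOn hU (hq.differentiableOn one_ne_zero)
        hτ hu).mul (h.hasFDerivAt τ hτ u hu)) ht hs
    refine key.congr_fderiv (Eq.symm ?_)
    ext1 v
    rw [ContinuousLinearMap.intervalIntegral_apply ((hslice hF').intervalIntegrable_of_Icc hs.1)]
    have hderiv : ∀ u ∈ Ioo 0 s, HasDerivAt (fun u => f (t, u) * X (t, u) v * J (t, u))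
        (fderivWithin ℝ (fun p => f p * X p v) (U ×ˢ Icc (0 : ℝ) 1) (t, u) (0, 1) * J (t, u)
          + f (t, u) * X (t, u) v * (B (t, u) * x' (t, u))) u := fun u hu =>
      have hu' : u ∈ Ioo (0 : ℝ) 1 := ⟨hu.1, hu.2.trans_le hs.2⟩
      (hasDerivAt_right_of_differentiableOn ((hfX v).differentiableOn one_ne_zero) ht hu').mul
        (h.hasDerivAt t ht u hu')
    have hD : ContinuousOn (fun u => η (t, u) * J (t, u) + q (t, u) * D (t, u)) (Icc 0 s) :=
      hslice ((hη.mul h.continuousOn).add (hq.continuousOn.mul h.continuousOn_deriv))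
    have hcongr : EqOn (fun u => (q (t, u) • (D (t, u) • ContinuousLinearMap.id ℝ ℂ
        + B (t, u) • X (t, u)) + J (t, u) • (fderivWithin ℝ q (U ×ˢ Icc (0 : ℝ) 1) (t, u)).comp
        (ContinuousLinearMap.inl ℝ ℂ ℝ)) v)
        (fun u => v * (η (t, u) * J (t, u) + q (t, u) * D (t, u))
        + (fderivWithin ℝ (fun p => f p * X p v) (U ×ˢ Icc (0 : ℝ) 1) (t, u) (0, 1) * J (t, u)
          + f (t, u) * X (t, u) v * (B (t, u) * x' (t, u)))) (Icc 0 s) := by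
      intro u hu
      simp only [add_apply, smul_apply,
        ContinuousLinearMap.comp_apply, ContinuousLinearMap.inl_apply, smul_eq_mul,
        ContinuousLinearMap.id_apply, hvar v (t, u) (hsub u hu)]
      linear_combination B (t, u) * X (t, u) v * hqf (t, u) (hsub u hu)
    have hint : IntervalIntegrable (fun u =>
        fderivWithin ℝ (fun p => f p * X p v) (U ×ˢ Icc (0 : ℝ) 1) (t, u) (0, 1) * J (t, u)
          + f (t, u) * X (t, u) v * (B (t, u) * x' (t, u))) volume 0 s := by
      have h1 : ContinuousOn (fun u => (q (t, u) • (D (t, u) • ContinuousLinearMap.id ℝ ℂ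
        + B (t, u) • X (t, u)) + J (t, u) • (fderivWithin ℝ q (U ×ˢ Icc (0 : ℝ) 1) (t, u)).comp
        (ContinuousLinearMap.inl ℝ ℂ ℝ)) v) (Icc 0 s) :=
        (hslice hF').clm_apply continuousOn_const
      refine ContinuousOn.intervalIntegrable_of_Icc hs.1
        ((h1.sub (continuousOn_const (c := v) |>.mul hD)).congr fun u hu => ?_)
      have hu' := hcongr hu
      simp only at hu'
      rw [Pi.sub_apply, hu', Pi.mul_apply]
      ring
    rw [← uIcc_of_le hs.1] at hcongr
    rw [intervalIntegral.integral_congr hcongr,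
      intervalIntegral.integral_add ((hD.intervalIntegrable_of_Icc hs.1).const_mul v) hint,
      intervalIntegral.integral_eq_sub_of_hasDerivAt_of_le hs.1
        (((hslice hf).mul ((hslice hX).clm_apply continuousOn_const)).mul
          (hslice h.continuousOn)) hderiv hint,
      intervalIntegral.integral_const_mul]
    simp [hX0 t ht]
    ring
  hasDerivAt t ht s hs := by
    have hcont : ContinuousOn (fun u => q (t, u) * J (t, u)) (Icc (0 : ℝ) 1) :=
      (hq.continuousOn.mul h.continuousOn).comp (by fun_prop) fun u hu => ⟨ht, hu⟩
    have hnhds := Icc_mem_nhds hs.1 hs.2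
    have hd := intervalIntegral.integral_hasDerivAt_right
      ((hcont.mono (Icc_subset_Icc_right hs.2.le)).intervalIntegrable_of_Icc hs.1.le)
      ⟨Icc 0 1, hnhds, hcont.aestronglyMeasurable measurableSet_Icc⟩
      (hcont.continuousAt hnhds)
    refine hd.congr_deriv ?_
    rw [hqf (t, s) ⟨ht, Ioo_subset_Icc_self hs⟩]
    ring

theorem prod_Icc_subset_closure_interior {U : Set ℂ} (hU : IsOpen U) :
    U ×ˢ Icc (0 : ℝ) 1 ⊆ closure (interior (U ×ˢ Icc (0 : ℝ) 1)) := by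
  rw [interior_prod_eq, hU.interior_eq, interior_Icc, closure_prod_eq, closure_Ioo zero_ne_one]
  exact prod_mono_left subset_closure

section Family

variable {U : Set ℂ} {Γ : ℂ → ℝ → ℂ × ℂ}

theorem pull_eq_pullWithin
    (hΓ : ContDiffOn ℝ 2 (fun p : ℂ × ℝ => Γ p.1 p.2) (U ×ˢ Icc (0 : ℝ) 1)) (ω : Form1)
    {t : ℂ} (ht : t ∈ U) {s : ℝ} (hs : s ∈ Ioo (0 : ℝ) 1) :
    pull (Γ t) ω s =
      pullWithin (fun p => Γ p.1 p.2) (U ×ˢ Icc (0 : ℝ) 1) ω (0, 1) (t, s) := by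
  have h := hasDerivAt_right_of_differentiableOn (hΓ.differentiableOn two_ne_zero) ht hs
  have h1 : HasDerivAt (fun u => (Γ t u).1) _ s := h.fst
  have h2 : HasDerivAt (fun u => (Γ t u).2) _ s := h.snd
  rw [pull, h1.deriv, h2.deriv, pullWithin]

theorem iterInt_cons_eq
    (hΓ : ContDiffOn ℝ 2 (fun p : ℂ × ℝ => Γ p.1 p.2) (U ×ˢ Icc (0 : ℝ) 1)) (ω : Form1)
    (L : List Form1) {p : ℂ × ℝ} (hp : p ∈ U ×ˢ Icc (0 : ℝ) 1) :
    iterInt (Γ p.1) (ω :: L) p.2 = ∫ u in (0 : ℝ)..p.2,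
      pullWithin (fun p => Γ p.1 p.2) (U ×ˢ Icc (0 : ℝ) 1) ω (0, 1) (p.1, u)
        * iterInt (Γ p.1) L u :=
  intervalIntegral.integral_congr_Ioo_of_le hp.2.1 fun u hu => by
    simp only [pull_eq_pullWithin hΓ ω hp.1 ⟨hu.1, hu.2.trans_le hp.2.2⟩]

theorem continuousOn_iterInt {W : Set (ℂ × ℂ)} (hW : IsOpen W) (hU : IsOpen U)
    (hΓ : ContDiffOn ℝ 2 (fun p : ℂ × ℝ => Γ p.1 p.2) (U ×ˢ Icc (0 : ℝ) 1))
    (hΓW : MapsTo (fun p : ℂ × ℝ => Γ p.1 p.2) (U ×ˢ Icc (0 : ℝ) 1) W)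
    (L : List Form1) (hL : ∀ ω ∈ L, HolFormOn W ω) :
    ContinuousOn (fun p : ℂ × ℝ => iterInt (Γ p.1) L p.2) (U ×ˢ Icc (0 : ℝ) 1) := by
  induction L with
  | nil => exact continuousOn_const
  | cons ω L ih =>
    have hω := (contDiffOn_pullWithin (hU.uniqueDiffOn.prod uniqueDiffOn_Icc_zero_one) hΓ hW hΓW
      (hL ω List.mem_cons_self) (0, 1)).continuousOn
    exact (continuousOn_parametric_primitive
      (hω.mul (ih fun ω' h => hL ω' (List.mem_cons_of_mem ω h)))).congr
      fun p hp => iterInt_cons_eq hΓ ω L hp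

/-- First variation of the iterated integrals of `ω i`, `i ∈ l`, over initial segments of the
cycles `Γ t`, where `X` is the `x`-component of the variation field. -/
theorem exists_hasVariation_iterInt {W : Set (ℂ × ℂ)} (hW : IsOpen W) {R : ℂ × ℂ → ℂ}
    (hR : DifferentiableOn ℂ R W) (hU : IsOpen U)
    (hΓ : ContDiffOn ℝ 2 (fun p : ℂ × ℝ => Γ p.1 p.2) (U ×ˢ Icc (0 : ℝ) 1))
    (hΓW : MapsTo (fun p : ℂ × ℝ => Γ p.1 p.2) (U ×ˢ Icc (0 : ℝ) 1) W)
    (hlevel : ∀ p ∈ U ×ˢ Icc (0 : ℝ) 1, R (Γ p.1 p.2) = p.1)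
    {x' : ℂ × ℝ → ℂ} {X : ℂ × ℝ → ℂ →L[ℝ] ℂ}
    (hx' : ∀ p, x' p = (fderivWithin ℝ (fun p : ℂ × ℝ => Γ p.1 p.2)
      (U ×ˢ Icc (0 : ℝ) 1) p (0, 1)).1)
    (hX : ∀ p v, X p v = (fderivWithin ℝ (fun p : ℂ × ℝ => Γ p.1 p.2)
      (U ×ˢ Icc (0 : ℝ) 1) p (v, 0)).1)
    (hX0 : ∀ t ∈ U, X (t, 0) = 0) {ω ξ : ℕ → Form1} (l : List ℕ) (hl : l.Nodup)
    (hω : ∀ i ∈ l, HolFormOn W (ω i)) (hξ : ∀ i ∈ l, HolFormOn W (ξ i))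
    (hdx : ∀ i ∈ l, (ω i).2 = fun _ => 0) (hGL : ∀ i ∈ l, IsGLDerivOn W R (ω i) (ξ i)) :
    ∃ B, HasVariation U x' X (fun p => iterInt (Γ p.1) (l.map ω) p.2)
      (fun p => ∑ i ∈ l.toFinset,
        iterInt (Γ p.1) (l.map (Function.update ω i (ξ i))) p.2) B := by
  have hUD : UniqueDiffOn ℝ (U ×ˢ Icc (0 : ℝ) 1) := hU.uniqueDiffOn.prod uniqueDiffOn_Icc_zero_one
  induction l with
  | nil =>
    refine ⟨fun _ => 0, continuousOn_const, by simpa using continuousOn_const,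
      continuousOn_const, fun t _ s _ => ?_, fun t _ s _ => ?_⟩
    · exact (hasFDerivAt_const (1 : ℂ) t).congr_fderiv (by ext; simp)
    · simpa [iterInt] using hasDerivAt_const (𝕜 := ℝ) s (1 : ℂ)
  | cons k l ih =>
    simp only [List.forall_mem_cons] at hω hξ hdx hGL
    obtain ⟨hk, hl⟩ := List.nodup_cons.1 hl
    obtain ⟨B, hB⟩ := ih hl hω.2 hξ.2 hdx.2 hGL.2
    have hpull : ∀ v p, pullWithin (fun p : ℂ × ℝ => Γ p.1 p.2) (U ×ˢ Icc (0 : ℝ) 1) (ω k)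
        (v, 0) p = (ω k).1 (Γ p.1 p.2) * X p v := by
      intro v p
      simp [pullWithin, hdx.1, hX]
    have hcont : ∀ {η : Form1}, HolFormOn W η → ContinuousOn
        (pullWithin (fun p : ℂ × ℝ => Γ p.1 p.2) (U ×ˢ Icc (0 : ℝ) 1) η (0, 1))
        (U ×ˢ Icc (0 : ℝ) 1) := fun hη =>
      (contDiffOn_pullWithin hUD hΓ hW hΓW hη (0, 1)).continuousOn
    refine ⟨_, (hB.cons hU hX0 (contDiffOn_pullWithin hUD hΓ hW hΓW hω.1 (0, 1)) (hcont hξ.1)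
      (f := fun p => (ω k).1 (Γ p.1 p.2)) (hω.1.1.continuousOn.comp hΓ.continuousOn hΓW)
      (continuousOn_clm_apply.2 fun v => ?_) (fun v => ?_) (fun p _ => ?_)
      (fun v p hp => ?_)).congr hU (fun p hp => iterInt_cons_eq hΓ _ _ hp) fun p hp => ?_⟩
    · simp only [hX]
      exact (contDiffOn_fderivWithin_apply_const hUD hΓ (v, 0)).continuousOn.fst
    · simp only [← hpull]
      exact contDiffOn_pullWithin hUD hΓ hW hΓW hω.1 (v, 0)
    · simp [pullWithin, hdx.1, hx']
    · have h := fderivWithin_pullWithin_sub hUD (prod_Icc_subset_closure_interior hU) hΓ hW hΓW hR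
        hlevel hω.1 hGL.1 (0, 1) (v, 0) hp
      simp only [← hpull]
      linear_combination h
    · have hmem : ∀ u ∈ uIcc 0 p.2, (p.1, u) ∈ U ×ˢ Icc (0 : ℝ) 1 := fun u hu => by
        rw [uIcc_of_le hp.2.1] at hu
        exact ⟨hp.1, hu.1, hu.2.trans hp.2.2⟩
      have hint : ∀ {g : ℂ × ℝ → ℂ}, ContinuousOn g (U ×ˢ Icc (0 : ℝ) 1) →
          IntervalIntegrable (fun u => g (p.1, u)) volume 0 p.2 := fun hg =>
        (hg.comp (by fun_prop) hmem).intervalIntegrable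
      have hterm : ∀ i ∈ l.toFinset, ContinuousOn (fun q : ℂ × ℝ =>
          pullWithin (fun p : ℂ × ℝ => Γ p.1 p.2) (U ×ˢ Icc (0 : ℝ) 1) (ω k) (0, 1) q
            * iterInt (Γ q.1) (l.map (Function.update ω i (ξ i))) q.2) (U ×ˢ Icc (0 : ℝ) 1) := by
        intro i hi
        refine (hcont hω.1).mul (continuousOn_iterInt hW hU hΓ hΓW _ ?_)
        simp only [List.forall_mem_map]
        intro j hj
        rcases eq_or_ne j i with rfl | hji
        · simpa using hξ.2 j hj
        · simpa [hji] using hω.2 j hj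
      have hmap : l.map (Function.update ω k (ξ k)) = l.map ω :=
        List.map_congr_left fun j hj => Function.update_of_ne (ne_of_mem_of_not_mem hj hk) _ _
      simp only
      rw [List.toFinset_cons, Finset.sum_insert (by simpa using hk), List.map_cons,
        Function.update_self, hmap, iterInt_cons_eq hΓ _ _ hp]
      refine Eq.trans ?_ (intervalIntegral.integral_add
        (hint ((hcont hξ.1).mul hB.continuousOn))
        (hint ((hcont hω.1).mul hB.continuousOn_deriv))).symm
      congr 1
      simp only [Pi.mul_apply]
      simp only [Finset.mul_sum]
      rw [intervalIntegral.integral_finsetSum fun i hi => hint (hterm i hi)]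
      refine Finset.sum_congr rfl fun i hi => ?_
      have hki : k ≠ i := (ne_of_mem_of_not_mem (List.mem_toFinset.1 hi) hk).symm
      rw [List.map_cons, Function.update_of_ne hki, iterInt_cons_eq hΓ _ _ hp]

end Family

/-- Differentiation of iterated integrals (forms with no `dy`-component): for a `C²` family
`Γ : U × [0,1] → W` of cycles on `{R = t}` with base points on the line `{x = 0}`, and
holomorphic 1-forms `ω₁, …, ω_n` of the form `f_i dx`, with Gelfand–Leray derivatives
`ξ_i` (`dω_i = dR ∧ ξ_i`),
`d/dt ∮ ω₁ ⋯ ω_n = Σ_{i=1}^n ∮ ω₁ ⋯ ω_{i−1} ξ_i ω_{i+1} ⋯ ω_n`. -/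
theorem gelfand_leray_iterated_dx
    (W : Set (ℂ × ℂ)) (hW : IsOpen W) (R : ℂ × ℂ → ℂ) (hR : DifferentiableOn ℂ R W)
    (U : Set ℂ) (hU : IsOpen U)
    (Γ : ℂ → ℝ → ℂ × ℂ)
    (hΓW : ∀ t ∈ U, ∀ s ∈ Set.Icc (0:ℝ) 1, Γ t s ∈ W)
    (hΓ : ContDiffOn ℝ 2 (fun p : ℂ × ℝ => Γ p.1 p.2) (U ×ˢ Set.Icc (0:ℝ) 1))
    (hlevel : ∀ t ∈ U, ∀ s ∈ Set.Icc (0:ℝ) 1, R (Γ t s) = t)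
    (hloop : ∀ t ∈ U, Γ t 0 = Γ t 1)
    (hbase : ∀ t ∈ U, (Γ t 0).1 = 0)
    (n : ℕ) (ω ξ : ℕ → Form1)
    (hω : ∀ i < n, HolFormOn W (ω i)) (hξ : ∀ i < n, HolFormOn W (ξ i))
    (hdx : ∀ i < n, (ω i).2 = fun _ => 0)
    (hGL : ∀ i < n, IsGLDerivOn W R (ω i) (ξ i)) :
    ∀ t ∈ U, HasDerivAt (fun τ => iterInt (Γ τ) ((List.range n).map ω) 1)
      (∑ i ∈ Finset.range n,
        iterInt (Γ t) ((List.range n).map (Function.update ω i (ξ i))) 1) t := by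
  intro t ht
  have hmaps : MapsTo (fun p : ℂ × ℝ => Γ p.1 p.2) (U ×ˢ Icc (0 : ℝ) 1) W :=
    fun p hp => hΓW p.1 hp.1 p.2 hp.2
  let X : ℂ × ℝ → ℂ →L[ℝ] ℂ := fun p => (ContinuousLinearMap.fst ℝ ℂ ℂ).comp
    ((fderivWithin ℝ (fun p : ℂ × ℝ => Γ p.1 p.2) (U ×ˢ Icc (0 : ℝ) 1) p).comp
      (ContinuousLinearMap.inl ℝ ℂ ℝ))
  have hXzero : ∀ s ∈ Icc (0 : ℝ) 1, (∀ τ ∈ U, (Γ τ s).1 = 0) → ∀ τ ∈ U, X (τ, s) = 0 := by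
    intro s hs hzero τ hτ
    have h1 : HasFDerivAt (fun τ => (Γ τ s).1) (X (τ, s)) τ :=
      (hasFDerivAt_left_of_differentiableOn hU (hΓ.differentiableOn two_ne_zero) hτ hs).fst
    have h2 : HasFDerivAt (fun τ => (Γ τ s).1) (0 : ℂ →L[ℝ] ℂ) τ :=
      (hasFDerivAt_const (0 : ℂ) τ).congr_of_eventuallyEq (by
        filter_upwards [hU.mem_nhds hτ] with σ hσ using hzero σ hσ)
    exact h1.unique h2
  obtain ⟨B, hB⟩ := exists_hasVariation_iterInt hW hR hU hΓ hmaps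
    (fun p hp => hlevel p.1 hp.1 p.2 hp.2) (fun _ => rfl) (X := X) (fun _ _ => rfl)
    (hXzero 0 (left_mem_Icc.2 zero_le_one) hbase) (List.range n) List.nodup_range
    (fun i hi => hω i (List.mem_range.1 hi)) (fun i hi => hξ i (List.mem_range.1 hi))
    (fun i hi => hdx i (List.mem_range.1 hi)) (fun i hi => hGL i (List.mem_range.1 hi))
  have h1 := right_mem_Icc.2 (zero_le_one (α := ℝ))
  have hd := hB.hasFDerivAt t ht 1 h1
  rw [hXzero 1 h1 (fun τ hτ => by rw [← hloop τ hτ, hbase τ hτ]) t ht, List.toFinset_range] at hd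
  refine hasFDerivAt_of_restrictScalars ℝ hd ?_
  ext v
  simp [mul_comm]
end
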